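/- arXiv:1802.09390 — 3 statements merged into one kernel-verified Lean document; each statement's English description precedes it below -/
import Mathlib

section
/- The function g defined for R > 0 by g(R) = (1/ sinh R) · ∫₀^R (sinh r)/r dr is strictly decreasing on (0, ∞): for all 0 < R₁ < R₂ one has g(R₂) < g(R₁). -/
/-- The function `r ↦ tanh r / r` is strictly decreasing on `(0, ∞)`. -/
theorem strictAntiOn_sinh_div_mul_cosh :
    StrictAntiOn (fun r : ℝ => Real.sinh r / (r * Real.cosh r)) (Set.Ioi 0) := by
  have hderiv (r : ℝ) (hr : 0 < r) :
      HasDerivAt (fun r : ℝ => Real.sinh r / (r * Real.cosh r))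
        ((Real.cosh r * (r * Real.cosh r) -
          Real.sinh r * (1 * Real.cosh r + r * Real.sinh r)) / (r * Real.cosh r) ^ 2) r :=
    (Real.hasDerivAt_sinh r).div ((hasDerivAt_id r).mul (Real.hasDerivAt_cosh r))
      (mul_pos hr (Real.cosh_pos r)).ne'
  refine strictAntiOn_of_deriv_neg (convex_Ioi 0)
    (fun r hr => (hderiv r hr).continuousAt.continuousWithinAt) fun r hr => ?_
  rw [interior_Ioi] at hr
  have hr : 0 < r := hr
  have hc := Real.cosh_pos r
  rw [(hderiv r hr).deriv]
  refine div_neg_of_neg_of_pos ?_ (by positivity)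
  have hsinh : 2 * r < Real.sinh (2 * r) := Real.self_lt_sinh_iff.2 (by positivity)
  rw [Real.sinh_two_mul] at hsinh
  have hsq : r * (Real.cosh r ^ 2 - Real.sinh r ^ 2) = r := by
    rw [Real.cosh_sq_sub_sinh_sq, mul_one]
  linarith

theorem intervalIntegrable_sinh_div_self (a b : ℝ) :
    IntervalIntegrable (fun r : ℝ => Real.sinh r / r) MeasureTheory.volume a b := by
  have hcont : Continuous (dslope Real.sinh 0) := by
    rw [← continuousOn_univ, continuousOn_dslope Filter.univ_mem]
    exact ⟨Real.continuous_sinh.continuousOn, Real.differentiable_sinh 0⟩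
  refine (hcont.intervalIntegrable a b).congr_ae (MeasureTheory.ae_restrict_of_ae ?_)
  filter_upwards [MeasureTheory.Measure.ae_ne MeasureTheory.volume (0 : ℝ)] with r hr
  simp [dslope_of_ne _ hr, slope_def_field]

/-- The function `g(R) = (1 / sinh R) * ∫₀^R (sinh r)/r dr` is strictly decreasing
on `(0, ∞)`: for all `0 < R₁ < R₂` one has `g(R₂) < g(R₁)`. -/
theorem sinh_integral_ratio_strictAnti (R₁ R₂ : ℝ) (hR₁ : 0 < R₁) (hR₁₂ : R₁ < R₂) :
    (1 / Real.sinh R₂) * ∫ r in (0:ℝ)..R₂, Real.sinh r / r <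
      (1 / Real.sinh R₁) * ∫ r in (0:ℝ)..R₁, Real.sinh r / r := by
  have hs₁ : 0 < Real.sinh R₁ := Real.sinh_pos_iff.2 hR₁
  have hs₁₂ : Real.sinh R₁ < Real.sinh R₂ := Real.sinh_lt_sinh.2 hR₁₂
  have heq (r : ℝ) :
      Real.sinh r / r = Real.sinh r / (r * Real.cosh r) * Real.cosh r := by
    rw [← div_div, div_mul_cancel₀ _ (Real.cosh_pos r).ne']
  set c := Real.sinh R₁ / (R₁ * Real.cosh R₁)
  have hcosh (a b : ℝ) : ∫ r in a..b, c * Real.cosh r = c * (Real.sinh b - Real.sinh a) := by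
    rw [intervalIntegral.integral_const_mul, intervalIntegral.integral_eq_sub_of_hasDerivAt
      (fun r _ => Real.hasDerivAt_sinh r) (Real.continuous_cosh.intervalIntegrable a b)]
  have hccont : Continuous fun r => c * Real.cosh r := Real.continuous_cosh.const_mul c
  have hlower : c * Real.sinh R₁ ≤ ∫ r in (0:ℝ)..R₁, Real.sinh r / r := by
    have h := intervalIntegral.integral_mono_on_of_le_Ioo hR₁.le
      (hccont.intervalIntegrable 0 R₁) (intervalIntegrable_sinh_div_self 0 R₁) fun r hr => by
        rw [heq r]
        exact mul_le_mul_of_nonneg_right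
          (strictAntiOn_sinh_div_mul_cosh hr.1 hR₁ hr.2).le (Real.cosh_pos r).le
    simpa [hcosh] using h
  have hupper : ∫ r in R₁..R₂, Real.sinh r / r < c * (Real.sinh R₂ - Real.sinh R₁) := by
    have hlt (r : ℝ) (hr : R₁ < r) : Real.sinh r / r < c * Real.cosh r := by
      rw [heq r]
      exact mul_lt_mul_of_pos_right
        (strictAntiOn_sinh_div_mul_cosh hR₁ (hR₁.trans hr) hr) (Real.cosh_pos r)
    rw [← hcosh]
    exact intervalIntegral.integral_lt_integral_of_continuousOn_of_le_of_exists_lt hR₁₂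
      (Real.continuous_sinh.continuousOn.div continuousOn_id
        fun r hr => (hR₁.trans_le hr.1).ne')
      hccont.continuousOn (fun r hr => (hlt r hr.1).le)
      ⟨R₂, Set.right_mem_Icc.2 hR₁₂.le, hlt R₂ hR₁₂⟩
  rw [← intervalIntegral.integral_add_adjacent_intervals
    (intervalIntegrable_sinh_div_self 0 R₁) (intervalIntegrable_sinh_div_self R₁ R₂),
    one_div_mul_eq_div, one_div_mul_eq_div, div_lt_div_iff₀ (hs₁.trans hs₁₂) hs₁]
  nlinarith [mul_le_mul_of_nonneg_right hlower (sub_pos.2 hs₁₂).le,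
    mul_lt_mul_of_pos_right hupper hs₁]
end

section
/- For every R > 0, setting c := (3/(2R sinh R))·(cosh R − ((1 + R²)/R)·sinh R), one has (1/R) · ∫₀^R ( −(3R/(z² sinh R))·(cosh z − (sinh z)/z) − c ) dz = (3/2)·(1 − (1/ sinh R) · ∫₀^R (sinh r)/r dr). -/
open MeasureTheory Set

/-- The continuous extension of `z ↦ sinh z / z` to `z = 0`. -/
noncomputable def sinhc : ℝ → ℝ := dslope Real.sinh 0

theorem continuous_sinhc : Continuous sinhc := by
  rw [← continuousOn_univ]
  exact (continuousOn_dslope Filter.univ_mem).2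
    ⟨Real.continuous_sinh.continuousOn, Real.differentiable_sinh 0⟩

theorem sinhc_of_ne_zero {z : ℝ} (hz : z ≠ 0) : sinhc z = Real.sinh z / z := by
  rw [sinhc, dslope_of_ne _ hz, slope_def_field, Real.sinh_zero, sub_zero, sub_zero]

theorem sinh_le_self_mul_cosh {z : ℝ} (hz : 0 ≤ z) : Real.sinh z ≤ z * Real.cosh z := by
  have hd : ∀ x : ℝ, HasDerivAt (fun x ↦ x * Real.cosh x - Real.sinh x) (x * Real.sinh x) x := by
    intro x
    convert! ((hasDerivAt_id x).mul (Real.hasDerivAt_cosh x)).sub (Real.hasDerivAt_sinh x) using 1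
    simp
  have hm : MonotoneOn (fun x : ℝ ↦ x * Real.cosh x - Real.sinh x) (Ici 0) := by
    refine monotoneOn_of_deriv_nonneg (convex_Ici 0)
      (fun x _ ↦ (hd x).continuousAt.continuousWithinAt)
      (fun x _ ↦ (hd x).differentiableAt.differentiableWithinAt) fun x hx ↦ ?_
    rw [interior_Ici] at hx
    rw [(hd x).deriv]
    exact mul_nonneg hx.le (Real.sinh_nonneg_iff.2 hx.le)
  simpa using hm self_mem_Ici hz hz

theorem self_mul_cosh_sub_sinh_le {z : ℝ} (hz : 0 ≤ z) :
    z * Real.cosh z - Real.sinh z ≤ z ^ 2 * Real.sinh z := by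
  have hd : ∀ x : ℝ, HasDerivAt (fun x ↦ x ^ 2 * Real.sinh x - (x * Real.cosh x - Real.sinh x))
      (x * Real.sinh x + x ^ 2 * Real.cosh x) x := by
    intro x
    convert! ((hasDerivAt_pow 2 x).mul (Real.hasDerivAt_sinh x)).sub
      (((hasDerivAt_id x).mul (Real.hasDerivAt_cosh x)).sub (Real.hasDerivAt_sinh x)) using 1
    simp
    ring
  have hm : MonotoneOn (fun x : ℝ ↦ x ^ 2 * Real.sinh x - (x * Real.cosh x - Real.sinh x))
      (Ici 0) := by
    refine monotoneOn_of_deriv_nonneg (convex_Ici 0)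
      (fun x _ ↦ (hd x).continuousAt.continuousWithinAt)
      (fun x _ ↦ (hd x).differentiableAt.differentiableWithinAt) fun x hx ↦ ?_
    rw [interior_Ici] at hx
    rw [(hd x).deriv]
    exact add_nonneg (mul_nonneg hx.le (Real.sinh_nonneg_iff.2 hx.le))
      (mul_nonneg (sq_nonneg x) (Real.cosh_pos x).le)
  simpa using hm self_mem_Ici hz hz

theorem continuousOn_sinh_sub_self_mul_cosh_div_sq :
    ContinuousOn (fun z : ℝ ↦ (Real.sinh z - z * Real.cosh z) / (2 * z ^ 2)) (Ici 0) := by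
  intro x hx
  rcases (mem_Ici.1 hx).eq_or_lt with rfl | hx
  · refine tendsto_iff_norm_sub_tendsto_zero.2 (squeeze_zero' (g := Real.sinh)
      (.of_forall fun _ ↦ norm_nonneg _) ?_ ?_)
    · filter_upwards [self_mem_nhdsWithin] with z hz
      rcases (mem_Ici.1 hz).eq_or_lt with rfl | hz
      · simp
      · have h₁ := sinh_le_self_mul_cosh hz.le
        have h₂ := self_mul_cosh_sub_sinh_le hz.le
        have h₃ := Real.sinh_pos_iff.2 hz
        have h₄ : 0 < z ^ 2 * Real.sinh z := by positivity
        simp only [ne_eq, OfNat.ofNat_ne_zero, not_false_eq_true, zero_pow, mul_zero, div_zero,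
          sub_zero, Real.norm_eq_abs]
        rw [abs_le, le_div_iff₀ (by positivity), div_le_iff₀ (by positivity)]
        constructor <;> nlinarith
    · simpa using Real.continuous_sinh.continuousWithinAt.tendsto (s := Ici (0 : ℝ)) (x := 0)
  · refine ContinuousAt.continuousWithinAt (ContinuousAt.div ?_ ?_ (by positivity))
    · exact (Real.continuous_sinh.sub (continuous_id.mul Real.continuous_cosh)).continuousAt
    · fun_prop

theorem hasDerivAt_sinh_sub_self_mul_cosh_div_sq {z : ℝ} (hz : z ≠ 0) :
    HasDerivAt (fun z : ℝ ↦ (Real.sinh z - z * Real.cosh z) / (2 * z ^ 2))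
      ((Real.cosh z - Real.sinh z / z) / z ^ 2 - Real.sinh z / z / 2) z := by
  convert! ((Real.hasDerivAt_sinh z).sub ((hasDerivAt_id z).mul (Real.hasDerivAt_cosh z))).div
    ((hasDerivAt_pow 2 z).const_mul 2) (by positivity) using 1
  simp
  field_simp
  ring

theorem integrable_and_integral_cosh_sub_sinh_div {R : ℝ} (hR : 0 < R) :
    IntervalIntegrable (fun z ↦ (Real.cosh z - Real.sinh z / z) / z ^ 2) volume 0 R ∧
    ∫ z in (0 : ℝ)..R, (Real.cosh z - Real.sinh z / z) / z ^ 2 =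
      (Real.sinh R - R * Real.cosh R) / (2 * R ^ 2) + (∫ z in (0 : ℝ)..R, Real.sinh z / z) / 2 := by
  let G : ℝ → ℝ := fun x ↦
    (Real.sinh x - x * Real.cosh x) / (2 * x ^ 2) + (∫ z in (0 : ℝ)..x, sinhc z) / 2
  have hS (x : ℝ) : HasDerivAt (fun x ↦ (∫ z in (0 : ℝ)..x, sinhc z) / 2) (sinhc x / 2) x :=
    (continuous_sinhc.integral_hasStrictDerivAt 0 x).hasDerivAt.div_const 2
  have hcont : ContinuousOn G (Icc 0 R) :=
    (continuousOn_sinh_sub_self_mul_cosh_div_sq.mono Icc_subset_Ici_self).add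
      fun x _ ↦ (hS x).continuousAt.continuousWithinAt
  have hderiv : ∀ x ∈ Ioo 0 R,
      HasDerivAt G ((Real.cosh x - Real.sinh x / x) / x ^ 2) x := by
    intro x hx
    convert! (hasDerivAt_sinh_sub_self_mul_cosh_div_sq hx.1.ne').add (hS x) using 1
    rw [sinhc_of_ne_zero hx.1.ne']
    ring
  have hint : IntervalIntegrable (fun z ↦ (Real.cosh z - Real.sinh z / z) / z ^ 2) volume 0 R := by
    rw [intervalIntegrable_iff_integrableOn_Ioc_of_le hR.le]
    refine intervalIntegral.integrableOn_deriv_of_nonneg hcont hderiv fun x hx ↦ ?_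
    refine div_nonneg (sub_nonneg.2 ?_) (sq_nonneg x)
    rw [div_le_iff₀' hx.1]
    exact sinh_le_self_mul_cosh hx.1.le
  have hsinhc : ∫ z in (0 : ℝ)..R, sinhc z = ∫ z in (0 : ℝ)..R, Real.sinh z / z := by
    refine intervalIntegral.integral_congr_ae (.of_forall fun x hx ↦ ?_)
    rw [uIoc_of_le hR.le] at hx
    exact sinhc_of_ne_zero hx.1.ne'
  refine ⟨hint, ?_⟩
  rw [intervalIntegral.integral_eq_sub_of_hasDerivAt_of_le hR.le hcont hderiv hint, ← hsinhc]
  simp [G]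

/-- For every `R > 0`, setting `c := (3/(2R sinh R))·(cosh R − ((1 + R²)/R)·sinh R)`, one has
`(1/R) · ∫₀^R ( −(3R/(z² sinh R))·(cosh z − (sinh z)/z) − c ) dz
  = (3/2)·(1 − (1/sinh R)·∫₀^R (sinh r)/r dr)`. -/
theorem average_B0_on_diameter (R : ℝ) (hR : 0 < R)
    (c : ℝ) (hc : c = (3 / (2 * R * Real.sinh R)) * (Real.cosh R - ((1 + R^2) / R) * Real.sinh R)) :
    (1 / R) * ∫ z in (0:ℝ)..R,
        (-(3 * R / (z^2 * Real.sinh R)) * (Real.cosh z - Real.sinh z / z) - c)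
      = (3/2) * (1 - (1 / Real.sinh R) * ∫ r in (0:ℝ)..R, Real.sinh r / r) := by
  obtain ⟨hint, hval⟩ := integrable_and_integral_cosh_sub_sinh_div hR
  have hs : Real.sinh R ≠ 0 := (Real.sinh_pos_iff.2 hR).ne'
  have hrw : ∀ z : ℝ, -(3 * R / (z ^ 2 * Real.sinh R)) * (Real.cosh z - Real.sinh z / z) - c =
      -(3 * R / Real.sinh R) * ((Real.cosh z - Real.sinh z / z) / z ^ 2) - c := fun z ↦ by
    rw [mul_comm (z ^ 2), ← div_div]
    ring
  simp only [hrw]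
  rw [intervalIntegral.integral_sub (hint.const_mul _) intervalIntegrable_const,
    intervalIntegral.integral_const_mul, hval, intervalIntegral.integral_const, hc, smul_eq_mul]
  field_simp
  ring
end

section
/- Let Ω ⊆ ℝ³ be open, let u' : Ω → ℂ be twice differentiable, let A' : Ω → ℝ³ be differentiable, let φ₀ : Ω → ℝ be twice differentiable, let B₀ : Ω → ℝ³ be twice differentiable, and let h ∈ ℝ. Set u := e^{i h φ₀}·u' and A := h·(curl B₀ + ∇φ₀) + A'. Then at every point of Ω, μ(u, A) = μ(u', A') + h·curl( (1 − |u'|²)·curl B₀ ). -/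
/-- Partial derivative `∂_k f` of a complex-valued function on `ℝ³`. -/
noncomputable def pdC (k : Fin 3) (f : (Fin 3 → ℝ) → ℂ) (x : Fin 3 → ℝ) : ℂ :=
  fderiv ℝ f x (Pi.single k 1)

/-- Partial derivative `∂_k f` of a real-valued function on `ℝ³`. -/
noncomputable def pdR (k : Fin 3) (f : (Fin 3 → ℝ) → ℝ) (x : Fin 3 → ℝ) : ℝ :=
  fderiv ℝ f x (Pi.single k 1)

/-- The real scalar product `(a,b) = Re (conj a · b)` on `ℂ ≅ ℝ²`. -/
noncomputable def cdot (a b : ℂ) : ℝ := ((starRingEnd ℂ) a * b).re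

/-- The superconducting current `j(u,A)_k = (iu, ∂_k u − i A_k u)`. -/
noncomputable def scurrent (u : (Fin 3 → ℝ) → ℂ) (A : (Fin 3 → ℝ) → Fin 3 → ℝ)
    (x : Fin 3 → ℝ) (k : Fin 3) : ℝ :=
  cdot (Complex.I * u x) (pdC k u x - Complex.I * (A x k) * u x)

/-- The curl of a vector field on `ℝ³`. -/
noncomputable def curl3 (F : (Fin 3 → ℝ) → Fin 3 → ℝ) (x : Fin 3 → ℝ) : Fin 3 → ℝ :=
  ![pdR 1 (fun y => F y 2) x - pdR 2 (fun y => F y 1) x,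
    pdR 2 (fun y => F y 0) x - pdR 0 (fun y => F y 2) x,
    pdR 0 (fun y => F y 1) x - pdR 1 (fun y => F y 0) x]

/-- The vorticity `μ(u,A) := curl j(u,A) + curl A` of a configuration `(u,A)`. -/
noncomputable def vorticity (u : (Fin 3 → ℝ) → ℂ) (A : (Fin 3 → ℝ) → Fin 3 → ℝ)
    (x : Fin 3 → ℝ) : Fin 3 → ℝ :=
  fun k => curl3 (fun y j => scurrent u A y j) x k + curl3 A x k

open Topology Filter

theorem curl3_congr {F G : (Fin 3 → ℝ) → Fin 3 → ℝ} {x : Fin 3 → ℝ} (h : F =ᶠ[𝓝 x] G) :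
    curl3 F x = curl3 G x := by
  have key : ∀ i j, pdR i (fun y => F y j) x = pdR i (fun y => G y j) x := fun i j => by
    have : (fun y => F y j) =ᶠ[𝓝 x] fun y => G y j := h.mono fun y hy => congrFun hy j
    simp only [pdR, this.fderiv_eq]
  simp only [curl3, key]

theorem curl3_add {F G : (Fin 3 → ℝ) → Fin 3 → ℝ} {x : Fin 3 → ℝ}
    (hF : DifferentiableAt ℝ F x) (hG : DifferentiableAt ℝ G x) (k : Fin 3) :
    curl3 (fun y j => F y j + G y j) x k = curl3 F x k + curl3 G x k := by
  have key : ∀ i j, pdR i (fun y => F y j + G y j) x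
      = pdR i (fun y => F y j) x + pdR i (fun y => G y j) x := fun i j => by
    simp only [pdR, fderiv_fun_add (differentiableAt_pi.1 hF j) (differentiableAt_pi.1 hG j),
      add_apply]
  fin_cases k <;> simp [curl3, key] <;> ring

theorem curl3_const_mul {F : (Fin 3 → ℝ) → Fin 3 → ℝ} {x : Fin 3 → ℝ}
    (hF : DifferentiableAt ℝ F x) (c : ℝ) (k : Fin 3) :
    curl3 (fun y j => c * F y j) x k = c * curl3 F x k := by
  have key : ∀ i j, pdR i (fun y => c * F y j) x = c * pdR i (fun y => F y j) x := fun i j => by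
    simp only [pdR, fderiv_const_mul (differentiableAt_pi.1 hF j),
      smul_apply, smul_eq_mul]
  fin_cases k <;> simp [curl3, key] <;> ring

theorem DifferentiableAt.pdR {f : (Fin 3 → ℝ) → ℝ} {x : Fin 3 → ℝ}
    (hf : DifferentiableAt ℝ (fderiv ℝ f) x) (k : Fin 3) :
    DifferentiableAt ℝ (fun y => pdR k f y) x :=
  hf.clm_apply (differentiableAt_const _)

theorem DifferentiableAt.pdC {f : (Fin 3 → ℝ) → ℂ} {x : Fin 3 → ℝ}
    (hf : DifferentiableAt ℝ (fderiv ℝ f) x) (k : Fin 3) :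
    DifferentiableAt ℝ (fun y => pdC k f y) x :=
  hf.clm_apply (differentiableAt_const _)

theorem curl3_grad {f : (Fin 3 → ℝ) → ℝ} {x : Fin 3 → ℝ}
    (hf : ∀ᶠ y in 𝓝 x, DifferentiableAt ℝ f y) (hf' : DifferentiableAt ℝ (fderiv ℝ f) x)
    (k : Fin 3) : curl3 (fun y j => pdR j f y) x k = 0 := by
  have key : ∀ i j, pdR i (fun y => pdR j f y) x
      = fderiv ℝ (fderiv ℝ f) x (Pi.single i 1) (Pi.single j 1) := fun i j => by
    have := hf'.hasFDerivAt.clm_apply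
      (hasFDerivAt_const (Pi.single j (1 : ℝ) : Fin 3 → ℝ) x)
    simp only [pdR, this.fderiv]
    simp
  have symm : ∀ v w, fderiv ℝ (fderiv ℝ f) x v w = fderiv ℝ (fderiv ℝ f) x w v :=
    second_derivative_symmetric_of_eventually_of_real
      (hf.mono fun y hy => hy.hasFDerivAt) hf'.hasFDerivAt
  fin_cases k <;> simp [curl3, key, sub_eq_zero] <;> exact symm _ _

theorem DifferentiableAt.curl3 {F : (Fin 3 → ℝ) → Fin 3 → ℝ} {x : Fin 3 → ℝ}
    (hF : ∀ᶠ y in 𝓝 x, DifferentiableAt ℝ F y) (hF' : DifferentiableAt ℝ (fderiv ℝ F) x) :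
    DifferentiableAt ℝ (fun y => curl3 F y) x := by
  have key : ∀ i j, DifferentiableAt ℝ (fun y => _root_.pdR i (fun z => F z j) y) x := fun i j => by
    have h1 : DifferentiableAt ℝ (fun y => fderiv ℝ F y (Pi.single i 1) j) x :=
      differentiableAt_pi.1 (hF'.clm_apply (differentiableAt_const _)) j
    refine h1.congr_of_eventuallyEq (hF.mono fun y hy => ?_)
    simp only [_root_.pdR, fderiv_apply hy j]
    rfl
  refine differentiableAt_pi.2 fun k => ?_
  fin_cases k <;> exact (key _ _).sub (key _ _)

theorem differentiableAt_normSq {u : (Fin 3 → ℝ) → ℂ} {x : Fin 3 → ℝ}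
    (hu : DifferentiableAt ℝ u x) : DifferentiableAt ℝ (fun y => Complex.normSq (u y)) x := by
  simp only [Complex.normSq_eq_norm_sq]
  exact hu.norm_sq ℝ

theorem DifferentiableAt.cdot {u v : (Fin 3 → ℝ) → ℂ} {x : Fin 3 → ℝ}
    (hu : DifferentiableAt ℝ u x) (hv : DifferentiableAt ℝ v x) :
    DifferentiableAt ℝ (fun y => cdot (u y) (v y)) x :=
  Complex.reCLM.differentiableAt.comp x
    ((Complex.conjCLE.differentiableAt.comp x hu).mul hv)

theorem DifferentiableAt.scurrent {u : (Fin 3 → ℝ) → ℂ} {A : (Fin 3 → ℝ) → Fin 3 → ℝ}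
    {x : Fin 3 → ℝ} (hu : DifferentiableAt ℝ u x) (hu' : DifferentiableAt ℝ (fderiv ℝ u) x)
    (hA : DifferentiableAt ℝ A x) : DifferentiableAt ℝ (fun y j => scurrent u A y j) x :=
  differentiableAt_pi.2 fun k =>
    (hu.const_mul _).cdot ((hu'.pdC k).sub
      (((Complex.ofRealCLM.differentiableAt.comp x (differentiableAt_pi.1 hA k)).const_mul _).mul
        hu))

theorem scurrent_eq (u : (Fin 3 → ℝ) → ℂ) (A : (Fin 3 → ℝ) → Fin 3 → ℝ) (x : Fin 3 → ℝ)
    (k : Fin 3) :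
    scurrent u A x k = cdot (Complex.I * u x) (pdC k u x) - A x k * Complex.normSq (u x) := by
  simp [scurrent, cdot, Complex.normSq_apply]
  ring

theorem pdC_phase_mul {u : (Fin 3 → ℝ) → ℂ} {θ : (Fin 3 → ℝ) → ℝ} {x : Fin 3 → ℝ}
    (hu : DifferentiableAt ℝ u x) (hθ : DifferentiableAt ℝ θ x) (k : Fin 3) :
    pdC k (fun y => Complex.exp (Complex.I * (θ y : ℂ)) * u y) x
      = Complex.exp (Complex.I * (θ x : ℂ)) * (pdC k u x + Complex.I * (pdR k θ x) * u x) := by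
  have h1 : HasFDerivAt (fun y => (θ y : ℂ)) (Complex.ofRealCLM ∘L fderiv ℝ θ x) x :=
    Complex.ofRealCLM.hasFDerivAt.comp x hθ.hasFDerivAt
  have h2 := ((h1.const_mul Complex.I).cexp).mul hu.hasFDerivAt
  have h3 := h2.fderiv
  simp only [pdC, pdR]
  erw [h3]
  simp
  ring

theorem cdot_mul_left (c a b : ℂ) : cdot (c * a) (c * b) = Complex.normSq c * cdot a b := by
  simp [cdot, Complex.normSq_apply]
  ring

theorem normSq_exp_I_mul (t : ℝ) : Complex.normSq (Complex.exp (Complex.I * (t : ℂ))) = 1 := by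
  rw [Complex.normSq_eq_norm_sq, mul_comm, Complex.norm_exp_ofReal_mul_I, one_pow]

/-- Gauge transformation law of the superconducting current. -/
theorem scurrent_phase_mul {u : (Fin 3 → ℝ) → ℂ} {θ : (Fin 3 → ℝ) → ℝ} {x : Fin 3 → ℝ}
    (A : (Fin 3 → ℝ) → Fin 3 → ℝ)
    (hu : DifferentiableAt ℝ u x) (hθ : DifferentiableAt ℝ θ x) (k : Fin 3) :
    scurrent (fun y => Complex.exp (Complex.I * (θ y : ℂ)) * u y) A x k
      = cdot (Complex.I * u x) (pdC k u x) + (pdR k θ x - A x k) * Complex.normSq (u x) := by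
  rw [scurrent_eq, pdC_phase_mul hu hθ, mul_left_comm, cdot_mul_left, Complex.normSq_mul,
    normSq_exp_I_mul]
  simp [cdot, Complex.normSq_apply]
  ring

/-- With `u := e^{i h φ₀}·u'` and `A := h·(curl B₀ + ∇φ₀) + A'`, where `u'`, `φ₀`, `B₀` are
twice differentiable and `A'` is differentiable on an open set `Ω ⊆ ℝ³`, one has at every
point of `Ω`:  `μ(u, A) = μ(u', A') + h·curl((1 − |u'|²)·curl B₀)`. -/
theorem vorticity_splitting (Ω : Set (Fin 3 → ℝ)) (hΩ : IsOpen Ω)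
    (u' : (Fin 3 → ℝ) → ℂ) (A' B₀ : (Fin 3 → ℝ) → Fin 3 → ℝ)
    (φ₀ : (Fin 3 → ℝ) → ℝ) (h : ℝ)
    (hu' : ∀ x ∈ Ω, DifferentiableAt ℝ u' x)
    (hu'' : ∀ x ∈ Ω, DifferentiableAt ℝ (fderiv ℝ u') x)
    (hA' : ∀ x ∈ Ω, DifferentiableAt ℝ A' x)
    (hφ₀ : ∀ x ∈ Ω, DifferentiableAt ℝ φ₀ x)
    (hφ₀' : ∀ x ∈ Ω, DifferentiableAt ℝ (fderiv ℝ φ₀) x)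
    (hB₀ : ∀ x ∈ Ω, DifferentiableAt ℝ B₀ x)
    (hB₀' : ∀ x ∈ Ω, DifferentiableAt ℝ (fderiv ℝ B₀) x)
    (u : (Fin 3 → ℝ) → ℂ) (A : (Fin 3 → ℝ) → Fin 3 → ℝ)
    (hu : u = fun x => Complex.exp (Complex.I * ((h * φ₀ x : ℝ) : ℂ)) * u' x)
    (hA : A = fun x k => h * (curl3 B₀ x k + pdR k φ₀ x) + A' x k) :
    ∀ x ∈ Ω, ∀ k : Fin 3,
      vorticity u A x k
        = vorticity u' A' x k
          + h * curl3 (fun y j => (1 - Complex.normSq (u' y)) * curl3 B₀ y j) x k := by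
  intro x hx k
  have ev : ∀ᶠ y in 𝓝 x, y ∈ Ω := hΩ.mem_nhds hx
  have hcurl : DifferentiableAt ℝ (fun y => curl3 B₀ y) x :=
    DifferentiableAt.curl3 (ev.mono hB₀) (hB₀' x hx)
  have hgrad : DifferentiableAt ℝ (fun y j => pdR j φ₀ y) x :=
    differentiableAt_pi.2 fun j => (hφ₀' x hx).pdR j
  have hS : DifferentiableAt ℝ (fun y j => scurrent u' A' y j) x :=
    (hu' x hx).scurrent (hu'' x hx) (hA' x hx)
  have hN : DifferentiableAt ℝ (fun y j => -Complex.normSq (u' y) * curl3 B₀ y j) x :=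
    differentiableAt_pi.2 fun j =>
      (differentiableAt_normSq (hu' x hx)).neg.mul (differentiableAt_pi.1 hcurl j)
  have hcur : (fun y j => scurrent u A y j) =ᶠ[𝓝 x] fun y j =>
      scurrent u' A' y j + h * (-Complex.normSq (u' y) * curl3 B₀ y j) := by
    filter_upwards [ev] with y hy
    ext j
    have hpd : pdR j (fun z => h * φ₀ z) y = h * pdR j φ₀ y := by
      simp [pdR, fderiv_const_mul (hφ₀ y hy)]
    rw [hu, scurrent_phase_mul A (hu' y hy) ((hφ₀ y hy).const_mul h), hpd, scurrent_eq, hA]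
    ring
  have hcM : curl3 (fun y j => (1 - Complex.normSq (u' y)) * curl3 B₀ y j) x k
      = curl3 (fun y => curl3 B₀ y) x k
        + curl3 (fun y j => -Complex.normSq (u' y) * curl3 B₀ y j) x k := by
    rw [← curl3_add hcurl hN]
    refine congrArg (fun F => curl3 F x k) (funext₂ fun y j => ?_)
    ring
  have hcA : curl3 A x k = h * curl3 (fun y => curl3 B₀ y) x k + curl3 A' x k := by
    have hsum : DifferentiableAt ℝ (fun y j => curl3 B₀ y j + pdR j φ₀ y) x := hcurl.add hgrad
    rw [hA, curl3_add (F := fun y j => h * (curl3 B₀ y j + pdR j φ₀ y))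
      (hsum.const_smul h) (hA' x hx), curl3_const_mul hsum, curl3_add hcurl hgrad,
      curl3_grad (ev.mono hφ₀) (hφ₀' x hx), add_zero]
  simp only [vorticity]
  rw [curl3_congr hcur,
    curl3_add (G := fun y j => h * (-Complex.normSq (u' y) * curl3 B₀ y j)) hS (hN.const_smul h),
    curl3_const_mul hN, hcA, hcM]
  ring
end
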